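/- arXiv:2410.22639 — 2 statements merged into one kernel-verified Lean document; each statement's English description precedes it below -/
import Mathlib

section
/- Let R be a discrete valuation ring with finite residue field of odd order q, maximal ideal P, and let m ≥ 1 and n ≥ 2 with l = ⌊n/2⌋. Then the number of unimodular isotropic vectors modulo Pᵐ satisfies |Cₙ(R/Pᵐ)| = (q^l − 1)(q^{l−1} + 1)·q^{(m−1)(n−1)} if n = 2l, and (q^{n−1} − 1)·q^{(m−1)(n−1)} if n = 2l+1. -/
open Matrix

/-- The split symmetric form. -/
def splitForm (R : Type*) [CommRing R] (n : ℕ) : Matrix (Fin n) (Fin n) R :=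
  Matrix.of fun i j =>
    if ((i : ℕ) < n / 2 ∧ (j : ℕ) = i + n / 2) ∨
       ((j : ℕ) < n / 2 ∧ (i : ℕ) = j + n / 2) ∨
       ((i : ℕ) = j ∧ (i : ℕ) = 2 * (n / 2)) then 1 else 0

/-- The set `Cₙ(R)` of unimodular isotropic vectors. -/
def unimodIsotropic (R : Type*) [CommRing R] (n : ℕ) : Set (Fin n → R) :=
  {x | Ideal.span (Set.range x) = ⊤ ∧ x ⬝ᵥ (splitForm R n *ᵥ x) = 0}

theorem card_and_eq_mul {α β : Type*} [Finite α] [Finite β] (P : α → Prop) (Q : α → β → Prop)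
    (k : ℕ) (h : ∀ a, P a → Nat.card {b // Q a b} = k) :
    Nat.card {p : α × β // P p.1 ∧ Q p.1 p.2} = Nat.card {a // P a} * k := by
  classical
  have := Fintype.ofFinite {a // P a}
  let e : {p : α × β // P p.1 ∧ Q p.1 p.2} ≃ Σ a : {a // P a}, {b // Q a b} :=
    { toFun := fun p => ⟨⟨p.1.1, p.2.1⟩, ⟨p.1.2, p.2.2⟩⟩
      invFun := fun s => ⟨(s.1.1, s.2.1), s.1.2, s.2.2⟩
      left_inv := fun _ => rfl
      right_inv := fun _ => rfl }
  rw [Nat.card_congr e, Nat.card_sigma, Finset.sum_congr rfl fun a _ => h a.1 a.2]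
  simp [Nat.card_eq_fintype_card]

section LocalRing

variable {A : Type*} [CommRing A]

theorem card_forall_mem {ι : Type*} [Fintype ι] (I : Ideal A) :
    Nat.card {y : ι → A // ∀ i, y i ∈ I} = Nat.card I ^ Fintype.card ι := by
  rw [Nat.card_congr (Equiv.subtypePiEquivPi (p := fun _ a => a ∈ I)), Nat.card_pi]
  simp

/-- The solutions in `I` of a linear equation having a unit among its coefficients. -/
theorem card_linear_solutions_mul {ι : Type*} [Fintype ι] (I : Ideal A) (x : ι → A)
    (hx : ∃ i, IsUnit (x i)) (c : A) (hc : c ∈ I) :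
    Nat.card {y : ι → A // (∀ i, y i ∈ I) ∧ ∑ i, x i * y i = c} * Nat.card I =
      Nat.card I ^ Fintype.card ι := by
  classical
  obtain ⟨i, u, hu⟩ := hx
  have key : ∀ (w : ι → A) (t : A),
      ∑ j, x j * (w + Pi.single i t : ι → A) j = ∑ j, x j * w j + u * t := by
    intro w t
    simp [mul_add, Finset.sum_add_distrib, Pi.single_apply, hu]
  have hmem : ∀ (w : ι → A) (t : A), (∀ j, w j ∈ I) → t ∈ I →
      ∀ j, (w + Pi.single i t : ι → A) j ∈ I := by
    intro w t hw ht j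
    refine I.add_mem (hw j) ?_
    by_cases h : j = i
    · subst h; simpa using ht
    · simp [h]
  have hsum : ∀ w : ι → A, (∀ j, w j ∈ I) → ∑ j, x j * w j ∈ I := fun w hw =>
    I.sum_mem fun j _ => I.mul_mem_left _ (hw j)
  let e : {y : ι → A // (∀ i, y i ∈ I) ∧ ∑ i, x i * y i = c} × I ≃
      {y : ι → A // ∀ i, y i ∈ I} :=
    { toFun := fun p => ⟨p.1.1 + Pi.single i p.2.1, hmem _ _ p.1.2.1 p.2.2⟩
      invFun := fun w =>
        have ht : (↑u⁻¹ : A) * (∑ j, x j * w.1 j - c) ∈ I :=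
          I.mul_mem_left _ (I.sub_mem (hsum _ w.2) hc)
        (⟨w.1 + Pi.single i (-(↑u⁻¹ * (∑ j, x j * w.1 j - c))),
          hmem _ _ w.2 (I.neg_mem ht), by rw [key]; simp⟩,
          ⟨↑u⁻¹ * (∑ j, x j * w.1 j - c), ht⟩)
      left_inv := by
        rintro ⟨⟨y, hy, hyc⟩, t, ht⟩
        have h : (↑u⁻¹ : A) * (∑ j, x j * (y + Pi.single i t : ι → A) j - c) = t := by
          rw [key, hyc]; simp
        refine Prod.ext (Subtype.ext ?_) (Subtype.ext h)
        simp only [h, Pi.single_neg]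
        abel
      right_inv := by
        rintro ⟨w, hw⟩
        refine Subtype.ext ?_
        simp only [Pi.single_neg]
        abel }
  rw [← Nat.card_prod, Nat.card_congr e, card_forall_mem]

theorem card_linear_solutions [Finite A] {k : ℕ} (I : Ideal A) (x : Fin (k + 1) → A)
    (hx : ∃ i, IsUnit (x i)) (c : A) (hc : c ∈ I) :
    Nat.card {y : Fin (k + 1) → A // (∀ i, y i ∈ I) ∧ ∑ i, x i * y i = c} = Nat.card I ^ k := by
  have h := card_linear_solutions_mul I x hx c hc
  rw [Fintype.card_fin, pow_succ] at h
  exact Nat.eq_of_mul_eq_mul_right Nat.card_pos h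

theorem toAddSubgroup_span_singleton_mul (π : A) (I : Ideal A) :
    (Ideal.span {π} * I).toAddSubgroup = I.toAddSubgroup.map (AddMonoidHom.mulLeft π) := by
  ext x
  exact Ideal.mem_span_singleton_mul

variable [IsLocalRing A]

open IsLocalRing

theorem span_range_eq_top_iff_exists_isUnit {ι : Type*} (x : ι → A) :
    Ideal.span (Set.range x) = ⊤ ↔ ∃ i, IsUnit (x i) := by
  refine ⟨fun h => ?_, fun ⟨i, hi⟩ => Ideal.eq_top_of_isUnit_mem _ (Ideal.subset_span ⟨i, rfl⟩) hi⟩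
  by_contra! hx
  have : Ideal.span (Set.range x) ≤ maximalIdeal A := by
    rw [Ideal.span_le]
    rintro _ ⟨i, rfl⟩
    exact (mem_maximalIdeal _).2 (hx i)
  rw [h, top_le_iff] at this
  exact (maximalIdeal.isMaximal A).ne_top this

theorem card_exists_isUnit_add [Finite A] {ι : Type*} [Fintype ι] :
    Nat.card {x : ι → A // ∃ i, IsUnit (x i)} + Nat.card (maximalIdeal A) ^ Fintype.card ι =
      Nat.card A ^ Fintype.card ι := by
  classical
  have h : Nat.card {x : ι → A // ¬ ∃ i, IsUnit (x i)} =
      Nat.card (maximalIdeal A) ^ Fintype.card ι := by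
    rw [← card_forall_mem]
    exact Nat.card_congr (Equiv.subtypeEquivRight fun x => by simp [mem_nonunits_iff])
  rw [← h, ← Nat.card_sum, Nat.card_congr (Equiv.sumCompl _)]
  simp [Nat.card_pi]

theorem card_prod_exists_isUnit_forall_mem [Finite A] (k e : ℕ) (I : Ideal A) :
    Nat.card {p : (Fin k → A) × (Fin e → A) // (∃ i, IsUnit (p.1 i)) ∧ ∀ j, p.2 j ∈ I} =
      (Nat.card A ^ k - Nat.card (maximalIdeal A) ^ k) * Nat.card I ^ e := by
  rw [card_and_eq_mul (fun x : Fin k → A => ∃ i, IsUnit (x i))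
    (fun _ (z : Fin e → A) => ∀ j, z j ∈ I)
    (Nat.card I ^ e) fun _ _ => by rw [card_forall_mem, Fintype.card_fin]]
  have h := card_exists_isUnit_add (A := A) (ι := Fin k)
  rw [Fintype.card_fin] at h
  rw [← h, Nat.add_sub_cancel]

theorem card_zeros_left_unimodular [Finite A] (k e : ℕ) (I : Ideal A) (c : (Fin e → A) → A)
    (hc : ∀ z, (∀ j, z j ∈ I) → c z ∈ I) :
    Nat.card {p : ((Fin (k + 1) → A) × (Fin e → A)) × (Fin (k + 1) → A) //
      ((∃ i, IsUnit (p.1.1 i)) ∧ ∀ j, p.1.2 j ∈ I) ∧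
        (∀ i, p.2 i ∈ I) ∧ ∑ i, p.1.1 i * p.2 i = c p.1.2} =
      (Nat.card A ^ (k + 1) - Nat.card (maximalIdeal A) ^ (k + 1)) * Nat.card I ^ (k + e) := by
  rw [card_and_eq_mul
    (fun p : (Fin (k + 1) → A) × (Fin e → A) => (∃ i, IsUnit (p.1 i)) ∧ ∀ j, p.2 j ∈ I)
    (fun p (y : Fin (k + 1) → A) => (∀ i, y i ∈ I) ∧ ∑ i, p.1 i * y i = c p.2)
    (Nat.card I ^ k) fun p hp => card_linear_solutions I p.1 hp.1 _ (hc _ hp.2),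
    card_prod_exists_isUnit_forall_mem, mul_assoc, ← pow_add, add_comm e]

/-- Unimodular zeros of the quadratic form `2 ∑ xᵢ yᵢ + ∑ zⱼ²` with at most one square. -/
theorem card_unimodular_zeros [Finite A] (h2 : IsUnit (2 : A)) (k e : ℕ) (he : e < 2) :
    Nat.card {p : ((Fin (k + 1) → A) × (Fin e → A)) × (Fin (k + 1) → A) //
      ((∃ i, IsUnit (p.1.1 i)) ∨ (∃ i, IsUnit (p.2 i)) ∨ ∃ i, IsUnit (p.1.2 i)) ∧
        2 * ∑ i, p.1.1 i * p.2 i + ∑ j, p.1.2 j ^ 2 = 0} =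
      (Nat.card A ^ (k + 1) - Nat.card (maximalIdeal A) ^ (k + 1)) *
        (Nat.card A ^ (k + e) + Nat.card (maximalIdeal A) ^ (k + e)) := by
  classical
  obtain ⟨u, hu⟩ := h2
  let V := Fin (k + 1) → A
  let W := Fin e → A
  have hsolve : ∀ s t : A, 2 * s + t = 0 ↔ s = ↑u⁻¹ * -t := by
    intro s t
    rw [← hu, Units.eq_inv_mul_iff_mul_eq, eq_neg_iff_add_eq_zero]
  let P₁ : (V × W) × V → Prop := fun p =>
    ((∃ i, IsUnit (p.1.1 i)) ∧ ∀ j, p.1.2 j ∈ (⊤ : Ideal A)) ∧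
      (∀ i, p.2 i ∈ (⊤ : Ideal A)) ∧ ∑ i, p.1.1 i * p.2 i = ↑u⁻¹ * -∑ j, p.1.2 j ^ 2
  let P₂ : (V × W) × V → Prop := fun p =>
    ((∃ i, IsUnit (p.1.1 i)) ∧ ∀ j, p.1.2 j ∈ maximalIdeal A) ∧
      (∀ i, p.2 i ∈ maximalIdeal A) ∧ ∑ i, p.1.1 i * p.2 i = ↑u⁻¹ * -∑ j, p.1.2 j ^ 2
  have c₁ : Nat.card {p // P₁ p} =
      (Nat.card A ^ (k + 1) - Nat.card (maximalIdeal A) ^ (k + 1)) * Nat.card A ^ (k + e) := by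
    have hA : Nat.card (⊤ : Ideal A) = Nat.card A := Nat.card_congr (Equiv.Set.univ A)
    have h := card_zeros_left_unimodular k e (⊤ : Ideal A)
      (fun z => ↑u⁻¹ * -∑ j, z j ^ 2) fun _ _ => Submodule.mem_top
    rwa [hA] at h
  have c₂ : Nat.card {p // P₂ p} =
      (Nat.card A ^ (k + 1) - Nat.card (maximalIdeal A) ^ (k + 1)) *
        Nat.card (maximalIdeal A) ^ (k + e) :=
    card_zeros_left_unimodular k e (maximalIdeal A) (fun z => ↑u⁻¹ * -∑ j, z j ^ 2) fun z hz =>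
      Ideal.mul_mem_left _ _ (neg_mem (Ideal.sum_mem _ fun j _ =>
        Ideal.pow_mem_of_mem _ (hz j) 2 two_pos))
  let σ : (V × W) × V ≃ (V × W) × V :=
    { toFun := fun p => ((p.2, p.1.2), p.1.1)
      invFun := fun p => ((p.2, p.1.2), p.1.1)
      left_inv := fun _ => rfl
      right_inv := fun _ => rfl }
  have hsplit : ∀ p : (V × W) × V,
      (((∃ i, IsUnit (p.1.1 i)) ∨ (∃ i, IsUnit (p.2 i)) ∨ ∃ i, IsUnit (p.1.2 i)) ∧
        2 * ∑ i, p.1.1 i * p.2 i + ∑ j, p.1.2 j ^ 2 = 0) ↔ P₁ p ∨ P₂ (σ p) := by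
    rintro ⟨⟨x, z⟩, y⟩
    simp only [hsolve, P₁, P₂, σ, Equiv.coe_fn_mk, Submodule.mem_top, implies_true, and_true,
      true_and]
    have hcomm : ∑ i, y i * x i = ∑ i, x i * y i := Finset.sum_congr rfl fun _ _ => mul_comm _ _
    rw [hcomm]
    constructor
    · rintro ⟨hun, hs⟩
      by_cases hx : ∃ i, IsUnit (x i)
      · exact Or.inl ⟨hx, hs⟩
      have hx' : ∀ i, x i ∈ maximalIdeal A := by
        simpa [mem_nonunits_iff] using hx
      have hzsum : ∑ j, z j ^ 2 ∈ maximalIdeal A := by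
        have h0 := (hsolve _ _).2 hs
        rw [eq_neg_of_add_eq_zero_right h0]
        exact neg_mem (Ideal.mul_mem_left _ _
          (Ideal.sum_mem _ fun i _ => Ideal.mul_mem_right _ _ (hx' i)))
      have hz : ∀ j, z j ∈ maximalIdeal A := by
        intro j
        have : ∑ j, z j ^ 2 = z j ^ 2 :=
          Finset.sum_eq_single j (fun b _ hb => absurd (Fin.ext (by omega)) hb) (by simp)
        rw [this] at hzsum
        exact (maximalIdeal.isMaximal A).isPrime.mem_of_pow_mem 2 hzsum
      refine Or.inr ⟨⟨?_, hz⟩, hx', hs⟩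
      rcases hun with h | h | ⟨j, hj⟩
      · exact absurd h hx
      · exact h
      · exact absurd hj ((mem_maximalIdeal _).1 (hz j))
    · rintro (⟨hx, hs⟩ | ⟨⟨hy, -⟩, -, hs⟩)
      · exact ⟨Or.inl hx, hs⟩
      · exact ⟨Or.inr (Or.inl hy), hs⟩
  have hdisj : Disjoint P₁ (fun p => P₂ (σ p)) := by
    rw [Pi.disjoint_iff]
    intro p
    rw [Prop.disjoint_iff]
    rintro ⟨⟨⟨⟨i, hi⟩, -⟩, -⟩, -, hx, -⟩
    exact (mem_maximalIdeal _).1 (hx i) hi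
  rw [Nat.card_congr ((Equiv.subtypeEquivRight hsplit).trans (subtypeOrEquiv _ _ hdisj)),
    Nat.card_sum, c₁, Nat.card_congr (σ.subtypeEquiv (q := P₂) fun _ => Iff.rfl), c₂]
  ring

theorem splitForm_append (R : Type*) [CommRing R] (l e : ℕ) (he : e < 2) (x y : Fin l → R)
    (z : Fin e → R) :
    Fin.append (Fin.append x y) z ⬝ᵥ
      (splitForm R (l + l + e) *ᵥ Fin.append (Fin.append x y) z) =
        2 * ∑ i, x i * y i + ∑ j, z j ^ 2 := by
  have hl : (l + l + e) / 2 = l := by omega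
  have h1 : ∀ i j : Fin l, splitForm R (l + l + e) ((i.castAdd l).castAdd e)
      ((j.castAdd l).castAdd e) = 0 := fun i j => by
    simp only [splitForm, Matrix.of_apply, hl, Fin.val_castAdd]; rw [if_neg (by omega)]
  have h2 : ∀ i j : Fin l, splitForm R (l + l + e) ((i.castAdd l).castAdd e)
      ((j.natAdd l).castAdd e) = if j = i then 1 else 0 := fun i j => by
    simp only [splitForm, Matrix.of_apply, hl, Fin.val_castAdd, Fin.val_natAdd, Fin.ext_iff]
    exact if_congr (by omega) rfl rfl
  have h3 : ∀ i j : Fin l, splitForm R (l + l + e) ((i.natAdd l).castAdd e)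
      ((j.castAdd l).castAdd e) = if j = i then 1 else 0 := fun i j => by
    simp only [splitForm, Matrix.of_apply, hl, Fin.val_castAdd, Fin.val_natAdd, Fin.ext_iff]
    exact if_congr (by omega) rfl rfl
  have h4 : ∀ i j : Fin l, splitForm R (l + l + e) ((i.natAdd l).castAdd e)
      ((j.natAdd l).castAdd e) = 0 := fun i j => by
    simp only [splitForm, Matrix.of_apply, hl, Fin.val_castAdd, Fin.val_natAdd]
    rw [if_neg (by omega)]
  have h5 : ∀ (i : Fin (l + l)) (j : Fin e), splitForm R (l + l + e) (i.castAdd e)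
      (j.natAdd (l + l)) = 0 := fun i j => by
    simp only [splitForm, Matrix.of_apply, hl, Fin.val_castAdd, Fin.val_natAdd]
    rw [if_neg (by omega)]
  have h6 : ∀ (i : Fin (l + l)) (j : Fin e), splitForm R (l + l + e) (j.natAdd (l + l))
      (i.castAdd e) = 0 := fun i j => by
    simp only [splitForm, Matrix.of_apply, hl, Fin.val_castAdd, Fin.val_natAdd]
    rw [if_neg (by omega)]
  have h7 : ∀ i j : Fin e, splitForm R (l + l + e) (i.natAdd (l + l))
      (j.natAdd (l + l)) = if j = i then 1 else 0 := fun i j => by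
    simp only [splitForm, Matrix.of_apply, hl, Fin.val_natAdd, Fin.ext_iff]
    exact if_congr (by omega) rfl rfl
  simp only [dotProduct, mulVec, Fin.sum_univ_add, Fin.append_left, Fin.append_right,
    h1, h2, h3, h4, h5, h6, h7, ite_mul, one_mul, zero_mul, Finset.sum_ite_eq',
    Finset.sum_const_zero, Finset.mem_univ, if_true, add_zero, zero_add]
  simp only [mul_comm (y _), ← pow_two]
  ring

theorem card_unimodIsotropic [Finite A] (h2 : IsUnit (2 : A)) (k e : ℕ) (he : e < 2) :
    Nat.card (unimodIsotropic A (k + 1 + (k + 1) + e)) =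
      (Nat.card A ^ (k + 1) - Nat.card (maximalIdeal A) ^ (k + 1)) *
        (Nat.card A ^ (k + e) + Nat.card (maximalIdeal A) ^ (k + e)) := by
  rw [← card_unimodular_zeros h2 k e he]
  let V := Fin (k + 1) → A
  let W := Fin e → A
  let τ : (V × W) × V ≃ (V × V) × W :=
    { toFun := fun p => ((p.1.1, p.2), p.1.2)
      invFun := fun p => ((p.1.1, p.2), p.1.2)
      left_inv := fun _ => rfl
      right_inv := fun _ => rfl }
  refine (Nat.card_congr ((τ.trans ((Equiv.prodCongrLeft fun _ => Fin.appendEquiv _ _).trans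
    (Fin.appendEquiv _ _))).subtypeEquiv ?_)).symm
  rintro ⟨⟨x, z⟩, y⟩
  change _ ↔ Ideal.span (Set.range (Fin.append (Fin.append x y) z)) = ⊤ ∧
    Fin.append (Fin.append x y) z ⬝ᵥ
      (splitForm A _ *ᵥ Fin.append (Fin.append x y) z) = 0
  rw [splitForm_append A _ _ he, span_range_eq_top_iff_exists_isUnit]
  have hor : ∀ {a b : ℕ} (f : Fin a → A) (g : Fin b → A),
      (∃ i, IsUnit (Fin.append f g i)) ↔ (∃ i, IsUnit (f i)) ∨ ∃ i, IsUnit (g i) := by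
    intro a b f g
    refine ⟨fun ⟨i, hi⟩ => ?_, ?_⟩
    · induction i using Fin.addCases with
      | left i => exact Or.inl ⟨i, by simpa using hi⟩
      | right i => exact Or.inr ⟨i, by simpa using hi⟩
    · rintro (⟨i, hi⟩ | ⟨i, hi⟩)
      · exact ⟨i.castAdd b, by simpa using hi⟩
      · exact ⟨i.natAdd a, by simpa using hi⟩
  simp only [hor, or_assoc]

theorem index_maximalIdeal_pow {π : A} (hgen : maximalIdeal A = Ideal.span {π})
    (hreg : ∀ a : A, π * a = 0 → a = 0) (m : ℕ) :
    ((maximalIdeal A) ^ m).toAddSubgroup.index = (maximalIdeal A).toAddSubgroup.index ^ m := by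
  have hinj : Function.Injective (AddMonoidHom.mulLeft π) :=
    (injective_iff_map_eq_zero _).2 hreg
  induction m with
  | zero =>
    rw [pow_zero, pow_zero, Ideal.one_eq_top]
    exact AddSubgroup.index_top
  | succ m ih =>
    have hle : ((maximalIdeal A) ^ (m + 1)).toAddSubgroup ≤ (maximalIdeal A).toAddSubgroup :=
      Ideal.pow_le_self m.succ_ne_zero
    have hm : ((maximalIdeal A) ^ (m + 1)).toAddSubgroup =
        ((maximalIdeal A) ^ m).toAddSubgroup.map (AddMonoidHom.mulLeft π) := by
      rw [← toAddSubgroup_span_singleton_mul, ← hgen, pow_succ']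
    have h1 : (maximalIdeal A).toAddSubgroup =
        (⊤ : AddSubgroup A).map (AddMonoidHom.mulLeft π) := by
      have h := toAddSubgroup_span_singleton_mul π (⊤ : Ideal A)
      rwa [Ideal.mul_top, ← hgen] at h
    have hrel : ((maximalIdeal A) ^ (m + 1)).toAddSubgroup.relIndex
        (maximalIdeal A).toAddSubgroup = ((maximalIdeal A) ^ m).toAddSubgroup.index := by
      rw [hm, h1, AddSubgroup.relIndex_map_map_of_injective _ _ hinj,
        AddSubgroup.relIndex_top_right]
    rw [← AddSubgroup.relIndex_mul_index hle, hrel, ih, pow_succ]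

theorem isUnit_two_of_odd_card_residueField [Fintype (ResidueField A)]
    (hq : Odd (Fintype.card (ResidueField A))) : IsUnit (2 : A) := by
  by_contra h
  have h0 : residue A 2 = 0 := (residue_eq_zero_iff _).2 h
  have h2 : (2 : ResidueField A) = 0 := by rwa [map_ofNat] at h0
  obtain ⟨j, hj⟩ := hq
  have hc := Nat.cast_card_eq_zero (ResidueField A)
  rw [hj] at hc
  simp [h2] at hc

/-- The index of the maximal ideal is unchanged in a nontrivial quotient. -/
theorem index_maximalIdeal_quotient (I : Ideal A) [IsLocalRing (A ⧸ I)] :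
    (maximalIdeal (A ⧸ I)).toAddSubgroup.index = (maximalIdeal A).toAddSubgroup.index := by
  have hsurj : Function.Surjective (Ideal.Quotient.mk I) := Ideal.Quotient.mk_surjective
  have hcomap : (maximalIdeal (A ⧸ I)).comap (Ideal.Quotient.mk I) = maximalIdeal A :=
    eq_maximalIdeal (Ideal.comap_isMaximal_of_surjective _ hsurj)
  rw [← hcomap]
  exact (AddSubgroup.index_comap_of_surjective (maximalIdeal (A ⧸ I)).toAddSubgroup
    (f := (Ideal.Quotient.mk I).toAddMonoidHom) hsurj).symm

end LocalRing

theorem pow_sub_pow_mul_pow_add_pow (q r k e : ℕ) :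
    ((q ^ (r + 1)) ^ (k + 1) - (q ^ r) ^ (k + 1)) * ((q ^ (r + 1)) ^ (k + e) + (q ^ r) ^ (k + e)) =
      (q ^ (k + 1) - 1) * (q ^ (k + e) + 1) * q ^ (r * (k + 1 + k + e)) := by
  have h : (q ^ (r + 1)) ^ (k + 1) - (q ^ r) ^ (k + 1) =
      (q ^ r) ^ (k + 1) * (q ^ (k + 1) - 1) := by
    rw [Nat.mul_sub, mul_one, ← mul_pow, ← pow_succ]
  rw [h]
  ring

theorem card_unimod_isotropic_mod_maximal_ideal_power
    {R : Type*} [CommRing R] [IsLocalRing R]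
    (π : R) (hπgen : IsLocalRing.maximalIdeal R = Ideal.span {π})
    (hπreg : ∀ a : R, π * a = 0 → a = 0)
    [Fintype (IsLocalRing.ResidueField R)]
    (hq : Odd (Fintype.card (IsLocalRing.ResidueField R)))
    (m n : ℕ) (hm : 1 ≤ m) (hn : 2 ≤ n) :
    Nat.card (unimodIsotropic (R ⧸ (IsLocalRing.maximalIdeal R) ^ m) n) =
      (if n % 2 = 0 then
        (Fintype.card (IsLocalRing.ResidueField R) ^ (n / 2) - 1) *
          (Fintype.card (IsLocalRing.ResidueField R) ^ (n / 2 - 1) + 1)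
      else
        Fintype.card (IsLocalRing.ResidueField R) ^ (n - 1) - 1) *
      Fintype.card (IsLocalRing.ResidueField R) ^ ((m - 1) * (n - 1)) := by
  obtain ⟨r, rfl⟩ : ∃ r, m = r + 1 := ⟨m - 1, by omega⟩
  obtain ⟨k, e, he, rfl⟩ : ∃ k e, e < 2 ∧ n = k + 1 + (k + 1) + e :=
    ⟨n / 2 - 1, n % 2, by omega, by omega⟩
  set q := Fintype.card (IsLocalRing.ResidueField R) with hqdef
  have hq0 : 0 < q := Fintype.card_pos
  have hP : (IsLocalRing.maximalIdeal R).toAddSubgroup.index = q := by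
    rw [hqdef, ← Nat.card_eq_fintype_card]
    rfl
  have hpow := index_maximalIdeal_pow hπgen hπreg (r + 1)
  rw [hP] at hpow
  set A := R ⧸ (IsLocalRing.maximalIdeal R) ^ (r + 1)
  have hA : Nat.card A = q ^ (r + 1) := hpow
  have : Finite A := Nat.finite_of_card_ne_zero (by rw [hA]; positivity)
  have : Nontrivial A := Ideal.Quotient.nontrivial_iff.2
    (ne_top_of_le_ne_top (IsLocalRing.maximalIdeal.isMaximal R).ne_top
      (Ideal.pow_le_self r.succ_ne_zero))
  have : IsLocalRing A := IsLocalRing.of_surjective' _ Ideal.Quotient.mk_surjective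
  have hM : Nat.card (IsLocalRing.maximalIdeal A) = q ^ r := by
    have h := (IsLocalRing.maximalIdeal A).toAddSubgroup.card_mul_index
    rw [index_maximalIdeal_quotient, hP] at h
    exact Nat.eq_of_mul_eq_mul_right hq0 (h.trans (hA.trans (pow_succ q r)))
  have h2 : IsUnit (2 : A) := by
    have h := (isUnit_two_of_odd_card_residueField hq).map
      (Ideal.Quotient.mk ((IsLocalRing.maximalIdeal R) ^ (r + 1)))
    rwa [map_ofNat] at h
  rw [card_unimodIsotropic h2 k e he, hA, hM, pow_sub_pow_mul_pow_add_pow]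
  have hr : r + 1 - 1 = r := by omega
  have hn1 : k + 1 + (k + 1) + e - 1 = k + 1 + k + e := by omega
  have hl : (k + 1 + (k + 1) + e) / 2 = k + 1 := by omega
  rw [hr, hn1, hl]
  congr 1
  interval_cases e
  · rw [if_pos (by omega)]
    simp
  · rw [if_neg (by omega), show k + 1 + k + 1 = (k + 1) * 2 by ring, pow_mul, mul_comm]
    simpa using (Nat.sq_sub_sq (q ^ (k + 1)) 1).symm
end

section
/- Let R be a local commutative ring with residue field of characteristic ≠ 2, I ⊊ R a proper ideal, n ≥ 2. Then the image of Oₙ(R) under reduction modulo I has cardinality |ρ_I(Oₙ(R))| = |ρ_I(Cₙ(R))| · |ρ_I(Tₙ(R))|, where Cₙ(R) is the Oₙ(R)-orbit of e₁ and Tₙ(R) is the stabilizer of e₁ in Oₙ(R). -/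
open Matrix

namespace Matrix

variable {ι R A : Type*} [Fintype ι] [CommRing R] [CommRing A]

/-- `{M | Mᵀ * S * M = S}` is closed under multiplication. -/
theorem transpose_mul_mul_mul {S M N : Matrix ι ι R} (hM : Mᵀ * S * M = S)
    (hN : Nᵀ * S * N = S) : (M * N)ᵀ * S * (M * N) = S := by
  calc (M * N)ᵀ * S * (M * N) = Nᵀ * (Mᵀ * S * M) * N := by
        simp only [transpose_mul, mul_assoc]
    _ = S := by rw [hM, hN]

theorem dotProduct_mulVec_of_transpose_mul_mul {S M : Matrix ι ι R} (hM : Mᵀ * S * M = S)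
    (x y : ι → R) : (M *ᵥ x) ⬝ᵥ S *ᵥ (M *ᵥ y) = x ⬝ᵥ S *ᵥ y := by
  rw [← vecMul_transpose, ← dotProduct_mulVec, mulVec_mulVec, mulVec_mulVec, hM]

variable [DecidableEq ι]

/-- The matrix of `x ↦ x - c • B(u, x) • u`, where `B` is the bilinear form with matrix `S`. -/
def formReflection (S : Matrix ι ι R) (c : R) (u : ι → R) : Matrix ι ι R :=
  1 - c • vecMulVec u (u ᵥ* S)

theorem formReflection_mulVec (S : Matrix ι ι R) (c : R) (u x : ι → R) :
    formReflection S c u *ᵥ x = x - (c * (u ⬝ᵥ S *ᵥ x)) • u := by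
  rw [formReflection, sub_mulVec, one_mulVec, smul_mulVec, vecMulVec_mulVec, dotProduct_mulVec]
  simp [smul_smul]

theorem formReflection_mul_self {S : Matrix ι ι R} {c : R} {u : ι → R}
    (hc : c * (u ⬝ᵥ S *ᵥ u) = 2) : formReflection S c u * formReflection S c u = 1 := by
  have h : c • ((u ᵥ* S) ⬝ᵥ u) = 2 := by rwa [← dotProduct_mulVec, smul_eq_mul]
  have key : (c • vecMulVec u (u ᵥ* S)) * (c • vecMulVec u (u ᵥ* S)) =
      (2 : R) • c • vecMulVec u (u ᵥ* S) := by
    rw [smul_mul_smul_comm, vecMulVec_mul_vecMulVec, vecMulVec_smul, smul_smul, smul_smul,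
      ← h, smul_eq_mul]
    congr 1
    ring
  rw [formReflection, sub_mul, one_mul, mul_sub, mul_one, key, two_smul]
  abel

theorem transpose_formReflection_mul_mul {S : Matrix ι ι R} (hS : Sᵀ = S) {c : R} {u : ι → R}
    (hc : c * (u ⬝ᵥ S *ᵥ u) = 2) :
    (formReflection S c u)ᵀ * S * formReflection S c u = S := by
  have h : (formReflection S c u)ᵀ * S = S * formReflection S c u := by
    have hu : S *ᵥ u = u ᵥ* S := by rw [← vecMul_transpose, hS]
    simp [formReflection, sub_mul, mul_sub, transpose_vecMulVec, mul_vecMulVec, vecMulVec_mul, hu]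
  rw [h, mul_assoc, formReflection_mul_self hc, mul_one]

theorem formReflection_map (φ : R →+* A) (S : Matrix ι ι R) (c : R) (u : ι → R) :
    (formReflection S c u).map φ = formReflection (S.map φ) (φ c) (φ ∘ u) := by
  ext i j
  simp [formReflection, vecMulVec_apply, RingHom.map_vecMul, one_apply, apply_ite φ]

/-- An isometry of a form with `S * S = 1` has an inverse which is again an isometry. -/
theorem exists_inv_of_transpose_mul_mul {S M : Matrix ι ι R} (hS : S * S = 1)
    (hM : Mᵀ * S * M = S) : ∃ N : Matrix ι ι R, Nᵀ * S * N = S ∧ N * M = 1 ∧ M * N = 1 := by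
  have hl : (S * Mᵀ * S) * M = 1 := by
    rw [mul_assoc S, mul_assoc S, hM, hS]
  have hr := mul_eq_one_comm.mp hl
  refine ⟨S * Mᵀ * S, ?_, hl, hr⟩
  generalize S * Mᵀ * S = N at hl hr
  calc Nᵀ * S * N = Nᵀ * (Mᵀ * S * M) * N := by rw [hM]
    _ = (M * N)ᵀ * S * (M * N) := by simp only [transpose_mul, mul_assoc]
    _ = S := by rw [hr]; simp

/-- An isometry fixing `e` modulo the kernel of `φ` is congruent to an isometry fixing `e`, for `e`
the first vector of a hyperbolic pair. -/
theorem exists_fixing_of_map_fixing {φ : R →+* A} [IsLocalHom φ] {S : Matrix ι ι R} (hS : Sᵀ = S)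
    {e f : ι → R} (he : e ⬝ᵥ S *ᵥ e = 0) (hf : f ⬝ᵥ S *ᵥ f = 0) (hef : e ⬝ᵥ S *ᵥ f = 1)
    {M : Matrix ι ι R} (hM : Mᵀ * S * M = S) (hMe : φ ∘ (M *ᵥ e) = φ ∘ e) :
    ∃ T : Matrix ι ι R, Tᵀ * S * T = S ∧ T *ᵥ e = e ∧ T.map φ = M.map φ := by
  have symm (x y : ι → R) : x ⬝ᵥ S *ᵥ y = y ⬝ᵥ S *ᵥ x := by
    rw [dotProduct_mulVec, dotProduct_comm, ← mulVec_transpose, hS]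
  set x := M *ᵥ e with hx
  have hxx : x ⬝ᵥ S *ᵥ x = 0 := by rw [hx, dotProduct_mulVec_of_transpose_mul_mul hM, he]
  have hφ : φ (x ⬝ᵥ S *ᵥ f) = 1 := by
    rw [RingHom.map_dotProduct, hMe, ← RingHom.map_dotProduct, hef, map_one]
  obtain ⟨a, ha⟩ : IsUnit (x ⬝ᵥ S *ᵥ f) := isUnit_of_map_unit φ _ (hφ ▸ isUnit_one)
  have hφa : φ (↑a⁻¹ : R) = 1 := by
    have := congrArg φ a.inv_mul
    rwa [map_mul, ha, hφ, mul_one, map_one] at this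
  have hcx : -(↑a⁻¹ : R) * ((x - f) ⬝ᵥ S *ᵥ (x - f)) = 2 := by
    simp only [mulVec_sub, sub_dotProduct, dotProduct_sub, symm f x, hxx, hf, ← ha]
    linear_combination 2 * a.inv_mul
  have hce : (-1 : R) * ((e - f) ⬝ᵥ S *ᵥ (e - f)) = 2 := by
    simp only [mulVec_sub, sub_dotProduct, dotProduct_sub, symm f e, he, hf, hef]
    ring
  have hsx : formReflection S (-(↑a⁻¹ : R)) (x - f) *ᵥ x = f := by
    rw [formReflection_mulVec, sub_dotProduct, symm f x, hxx, ← ha]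
    simp
  have hse : formReflection S (-1) (e - f) *ᵥ f = e := by
    rw [formReflection_mulVec, sub_dotProduct, hef, hf]
    simp
  have hmap : (formReflection S (-(↑a⁻¹ : R)) (x - f)).map φ =
      (formReflection S (-1) (e - f)).map φ := by
    have hv : φ ∘ (x - f) = φ ∘ (e - f) := by
      ext i
      simpa using congrFun hMe i
    rw [formReflection_map, formReflection_map, hv, map_neg, map_neg, hφa, map_one]
  refine ⟨formReflection S (-1) (e - f) * (formReflection S (-(↑a⁻¹ : R)) (x - f) * M),
    transpose_mul_mul_mul (transpose_formReflection_mul_mul hS hce)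
      (transpose_mul_mul_mul (transpose_formReflection_mul_mul hS hcx) hM), ?_, ?_⟩
  · rw [← mulVec_mulVec, ← mulVec_mulVec, ← hx, hsx, hse]
  · rw [Matrix.map_mul, Matrix.map_mul, hmap, ← mul_assoc, ← Matrix.map_mul,
      formReflection_mul_self hce]
    simp

/-- Orbit-stabilizer for the reduction of the isometry group of a form with `S * S = 1`, acting on
the first vector of a hyperbolic pair. -/
theorem card_image_map_eq_mul {φ : R →+* A} [IsLocalHom φ] {S : Matrix ι ι R} (hS : Sᵀ = S)
    (hSS : S * S = 1) {e f : ι → R} (he : e ⬝ᵥ S *ᵥ e = 0) (hf : f ⬝ᵥ S *ᵥ f = 0)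
    (hef : e ⬝ᵥ S *ᵥ f = 1) :
    Nat.card ((fun M : Matrix ι ι R => M.map φ) '' {M | Mᵀ * S * M = S}) =
      Nat.card ((fun x : ι → R => φ ∘ x) '' {x | ∃ M : Matrix ι ι R,
        Mᵀ * S * M = S ∧ M *ᵥ e = x}) *
      Nat.card ((fun M : Matrix ι ι R => M.map φ) '' {M | Mᵀ * S * M = S ∧ M *ᵥ e = e}) := by
  have mapMulVec (M : Matrix ι ι R) (x : ι → R) : φ ∘ (M *ᵥ x) = M.map φ *ᵥ (φ ∘ x) :=
    funext fun i => RingHom.map_mulVec φ M x i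
  have lift (c : (fun x : ι → R => φ ∘ x) '' {x | ∃ M : Matrix ι ι R,
      Mᵀ * S * M = S ∧ M *ᵥ e = x}) :
      ∃ M : Matrix ι ι R, Mᵀ * S * M = S ∧ φ ∘ (M *ᵥ e) = c := by
    obtain ⟨_, _, ⟨M, hM, rfl⟩, rfl⟩ := c
    exact ⟨M, hM, rfl⟩
  choose L hL hLe using lift
  have mem (c) (t : (fun M : Matrix ι ι R => M.map φ) '' {M | Mᵀ * S * M = S ∧ M *ᵥ e = e}) :
      (L c).map φ * t.1 ∈ (fun M : Matrix ι ι R => M.map φ) '' {M | Mᵀ * S * M = S} := by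
    obtain ⟨_, T, ⟨hT, -⟩, rfl⟩ := t
    exact ⟨L c * T, transpose_mul_mul_mul (hL c) hT, Matrix.map_mul⟩
  have fixes (t : (fun M : Matrix ι ι R => M.map φ) '' {M | Mᵀ * S * M = S ∧ M *ᵥ e = e}) :
      t.1 *ᵥ (φ ∘ e) = φ ∘ e := by
    obtain ⟨_, T, ⟨-, hT⟩, rfl⟩ := t
    rw [← mapMulVec, hT]
  rw [← Nat.card_prod]
  refine (Nat.card_congr (Equiv.ofBijective
    (fun p => ⟨(L p.1).map φ * p.2.1, mem p.1 p.2⟩) ⟨?_, ?_⟩)).symm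
  · rintro ⟨c, t⟩ ⟨c', t'⟩ h
    have h : (L c).map φ * t.1 = (L c').map φ * t'.1 := congrArg Subtype.val h
    have hc : c = c' := by
      have := congrArg (· *ᵥ (φ ∘ e)) h
      simp only [← mulVec_mulVec, fixes, ← mapMulVec, hLe] at this
      exact Subtype.ext this
    subst hc
    obtain ⟨N, -, hN, -⟩ := exists_inv_of_transpose_mul_mul hSS (hL c)
    have hN : N.map φ * (L c).map φ = 1 := by rw [← Matrix.map_mul, hN]; simp
    have := congrArg (N.map φ * ·) h
    simp only [← mul_assoc, hN, one_mul] at this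
    rw [Subtype.ext this]
  · rintro ⟨_, M, hM, rfl⟩
    let c : (fun x : ι → R => φ ∘ x) '' {x | ∃ M : Matrix ι ι R, Mᵀ * S * M = S ∧ M *ᵥ e = x} :=
      ⟨φ ∘ (M *ᵥ e), _, ⟨M, hM, rfl⟩, rfl⟩
    obtain ⟨N, hN, hNL, hLN⟩ := exists_inv_of_transpose_mul_mul hSS (hL c)
    have hfix : φ ∘ ((N * M) *ᵥ e) = φ ∘ e := by
      rw [← mulVec_mulVec, mapMulVec, show φ ∘ (M *ᵥ e) = φ ∘ (L c *ᵥ e) from (hLe c).symm,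
        ← mapMulVec, mulVec_mulVec, hNL, one_mulVec]
    obtain ⟨T, hT, hTe, hTM⟩ :=
      exists_fixing_of_map_fixing hS he hf hef (transpose_mul_mul_mul hN hM) hfix
    refine ⟨(c, ⟨_, T, ⟨hT, hTe⟩, rfl⟩), Subtype.ext ?_⟩
    change (L c).map φ * T.map φ = M.map φ
    rw [hTM, ← Matrix.map_mul, ← mul_assoc, hLN, one_mul]

end Matrix

theorem splitForm_transpose (R : Type*) [CommRing R] (n : ℕ) :
    (splitForm R n)ᵀ = splitForm R n := by
  ext i j
  simp only [splitForm, transpose_apply, of_apply]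
  congr 1
  apply propext
  omega

/-- The involution of the index set pairing `i` with `i + n / 2`, of which `splitForm` is the
permutation matrix. -/
def splitFormIndex {n : ℕ} (i : Fin n) : Fin n :=
  ⟨if (i : ℕ) < n / 2 then i + n / 2 else if (i : ℕ) < 2 * (n / 2) then i - n / 2 else i, by
    split_ifs <;> omega⟩

theorem splitForm_apply (R : Type*) [CommRing R] {n : ℕ} (i j : Fin n) :
    splitForm R n i j = if j = splitFormIndex i then 1 else 0 := by
  simp only [splitForm, of_apply, splitFormIndex, Fin.ext_iff]
  congr 1
  apply propext
  split_ifs <;> omega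

theorem splitFormIndex_splitFormIndex {n : ℕ} (i : Fin n) :
    splitFormIndex (splitFormIndex i) = i := by
  ext
  simp only [splitFormIndex]
  split_ifs <;> omega

theorem splitForm_mul_self (R : Type*) [CommRing R] (n : ℕ) :
    splitForm R n * splitForm R n = 1 := by
  ext i j
  simp only [mul_apply, splitForm_apply, ite_mul, one_mul, zero_mul, Finset.sum_ite_eq',
    Finset.mem_univ, if_true, splitFormIndex_splitFormIndex, one_apply, eq_comm (a := i)]

theorem card_reduction_orthogonal_eq_card_orbit_mul_card_stabilizer
    {R : Type*} [CommRing R] [IsLocalRing R]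
    (hchar : ringChar (IsLocalRing.ResidueField R) ≠ 2)
    (I : Ideal R) (hI : I ≠ ⊤) (n : ℕ) (hn : 2 ≤ n) :
    Nat.card ((fun M : Matrix (Fin n) (Fin n) R => M.map (Ideal.Quotient.mk I)) ''
        {M | Mᵀ * splitForm R n * M = splitForm R n}) =
      Nat.card ((fun x : Fin n → R => (Ideal.Quotient.mk I) ∘ x) ''
          {x | ∃ M : Matrix (Fin n) (Fin n) R,
            Mᵀ * splitForm R n * M = splitForm R n ∧
            M *ᵥ Pi.single (⟨0, by omega⟩ : Fin n) 1 = x}) *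
        Nat.card ((fun M : Matrix (Fin n) (Fin n) R => M.map (Ideal.Quotient.mk I)) ''
          {M | Mᵀ * splitForm R n * M = splitForm R n ∧
            M *ᵥ Pi.single (⟨0, by omega⟩ : Fin n) 1 =
              Pi.single (⟨0, by omega⟩ : Fin n) 1}) := by
  have : Nontrivial (R ⧸ I) := Ideal.Quotient.nontrivial_iff.mpr hI
  have : IsLocalHom (Ideal.Quotient.mk I) := .of_surjective _ Ideal.Quotient.mk_surjective
  refine card_image_map_eq_mul (f := Pi.single (⟨n / 2, by omega⟩ : Fin n) 1)
    (splitForm_transpose R n) (splitForm_mul_self R n) ?_ ?_ ?_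
  all_goals
    simp only [mulVec_single_one, single_one_dotProduct, col_apply, splitForm, of_apply]
  · exact if_neg (by omega)
  · exact if_neg (by omega)
  · exact if_pos (by omega)
end
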